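/- Let S be a measurable space, let κ be a Markov kernel on S satisfying ‖κ(s) − κ(s′)‖_TV ≤ 2α for all s, s′ ∈ S with α ∈ (0,1), with unique invariant probability measure μ∞, and let r̄ : S → ℝ be measurable with values in [0,1]. Set J := ∫ r̄ dμ∞. Then for every initial state s ∈ S and every horizon H ∈ ℕ, |H·J − Σ_{h=0}^{H−1} ∫ r̄(x) dμ_h^s(x)| ≤ 2/(1−α), where μ_h^s denotes the h-step distribution of κ started from the Dirac measure at s. -/

import Mathlib

open MeasureTheory

/-- Total variation distance: `‖μ − ν‖_TV = 2 · sup {|μ(B) − ν(B)| : B measurable}`. -/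
noncomputable def tvDist {S : Type*} [MeasurableSpace S] (μ ν : Measure S) : ℝ :=
  2 * ⨆ B : {B : Set S // MeasurableSet B}, |(μ B.1).toReal - (ν B.1).toReal|

/-- `stepIter κ t μ` is the `t`-step distribution, the `t`-fold iterate of
`μ ↦ bind μ κ` applied to `μ`. -/
noncomputable def stepIter {S : Type*} [MeasurableSpace S]
    (κ : S → Measure S) (t : ℕ) (μ : Measure S) : Measure S :=
  (fun m => m.bind κ)^[t] μ

/-- The integrals of a function of oscillation at most `c` against two probability measures
differ by at most `a * c` if the measures differ by at most `a` on every measurable set. -/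
theorem abs_integral_sub_integral_le_of_oscillation {S : Type*} [MeasurableSpace S]
    (μ ν : Measure S) [IsProbabilityMeasure μ] [IsProbabilityMeasure ν] {a c : ℝ}
    (h : ∀ B, MeasurableSet B → |μ.real B - ν.real B| ≤ a)
    {f : S → ℝ} (hf : Measurable f) (hosc : ∀ x y, f x - f y ≤ c) :
    |(∫ x, f x ∂μ) - ∫ x, f x ∂ν| ≤ a * c := by
  have : Nonempty S := nonempty_of_isProbabilityMeasure μ
  obtain ⟨x₀⟩ := this
  have hc : 0 ≤ c := by simpa using hosc x₀ x₀
  have hbdd : BddBelow (Set.range f) :=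
    ⟨f x₀ - c, by rintro _ ⟨y, rfl⟩; linarith [hosc x₀ y]⟩
  set m := ⨅ x, f x
  have h0 : ∀ x, 0 ≤ f x - m := fun x => sub_nonneg.2 (ciInf_le hbdd x)
  have h1 : ∀ x, f x - m ≤ c := fun x => by
    have : Nonempty S := ⟨x₀⟩
    have : f x - c ≤ m := le_ciInf fun y => by linarith [hosc x y]
    linarith
  have hint (ρ : Measure S) [IsProbabilityMeasure ρ] : Integrable (fun x => f x - m) ρ :=
    Integrable.of_bound (hf.sub_const m).aestronglyMeasurable c
      (.of_forall fun x => by rw [Real.norm_of_nonneg (h0 x)]; exact h1 x)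
  have hlayer (ρ : Measure S) [IsProbabilityMeasure ρ] :
      ∫ x, f x ∂ρ = m + ∫ t in Set.Ioc 0 c, ρ.real {x | t ≤ f x - m} := by
    rw [← (hint ρ).integral_eq_integral_Ioc_meas_le (.of_forall h0) (.of_forall h1)]
    have := integral_add (integrable_const m) (hint ρ)
    simpa using this
  have hlevel (ρ : Measure S) [IsProbabilityMeasure ρ] :
      IntegrableOn (fun t => ρ.real {x | t ≤ f x - m}) (Set.Ioc 0 c) := by
    have hanti : Antitone fun t => ρ.real {x | t ≤ f x - m} := fun s t hst =>
      measureReal_mono fun x (hx : t ≤ f x - m) => hst.trans hx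
    exact Integrable.of_bound hanti.measurable.aestronglyMeasurable 1
      (.of_forall fun t => by rw [Real.norm_of_nonneg measureReal_nonneg]; exact measureReal_le_one)
  rw [hlayer μ, hlayer ν, add_sub_add_left_eq_sub, ← integral_sub (hlevel μ) (hlevel ν)]
  have := norm_setIntegral_le_of_norm_le_const (μ := volume) (s := Set.Ioc 0 c)
    (f := fun t => μ.real {x | t ≤ f x - m} - ν.real {x | t ≤ f x - m}) (C := a)
    measure_Ioc_lt_top fun t _ =>
      h _ (measurableSet_le measurable_const (hf.sub_const m))
  simpa [hc] using this

/-- Two probability measures differ by at most half their total variation distance on every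
measurable set. -/
theorem two_mul_abs_measureReal_sub_le_tvDist {S : Type*} [MeasurableSpace S]
    (μ ν : Measure S) [IsProbabilityMeasure μ] [IsProbabilityMeasure ν]
    {B : Set S} (hB : MeasurableSet B) :
    2 * |μ.real B - ν.real B| ≤ tvDist μ ν := by
  have hbdd : BddAbove (Set.range fun B : {B : Set S // MeasurableSet B} =>
      |(μ B.1).toReal - (ν B.1).toReal|) := by
    refine ⟨1, ?_⟩
    rintro _ ⟨B, rfl⟩
    exact abs_sub_le_of_nonneg_of_le measureReal_nonneg measureReal_le_one
      measureReal_nonneg measureReal_le_one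
  exact mul_le_mul_of_nonneg_left (le_ciSup hbdd ⟨B, hB⟩) zero_le_two

theorem stepIter_succ {S : Type*} [MeasurableSpace S]
    (κ : S → Measure S) (t : ℕ) (μ : Measure S) :
    stepIter κ (t + 1) μ = (stepIter κ t μ).bind κ :=
  Function.iterate_succ_apply' _ _ _

theorem isProbabilityMeasure_stepIter {S : Type*} [MeasurableSpace S]
    {κ : S → Measure S} (hκm : Measurable κ) (hκp : ∀ s, IsProbabilityMeasure (κ s))
    (μ : Measure S) [IsProbabilityMeasure μ] (t : ℕ) :
    IsProbabilityMeasure (stepIter κ t μ) := by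
  induction t with
  | zero => assumption
  | succ t ih =>
    rw [stepIter_succ]
    exact isProbabilityMeasure_bind hκm.aemeasurable (.of_forall hκp)

/-- A Markov kernel satisfying the Doeblin condition contracts the distance to its invariant
measure, tested against functions of bounded oscillation. -/
theorem abs_integral_sub_integral_stepIter_le {S : Type*} [MeasurableSpace S]
    {κ : S → Measure S} (hκm : Measurable κ) (hκp : ∀ s, IsProbabilityMeasure (κ s))
    {α : ℝ} (hDoeblin : ∀ s s' : S, tvDist (κ s) (κ s') ≤ 2 * α)
    (π : Measure S) [IsProbabilityMeasure π] (hinv : π.bind κ = π)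
    (μ : Measure S) [IsProbabilityMeasure μ] (t : ℕ) {f : S → ℝ} (hf : Measurable f) {c : ℝ}
    (hosc : ∀ x y, f x - f y ≤ c) :
    |(∫ x, f x ∂π) - ∫ x, f x ∂(stepIter κ t μ)| ≤ α ^ t * c := by
  induction t generalizing f c with
  | zero =>
    rw [pow_zero]
    exact abs_integral_sub_integral_le_of_oscillation π μ (fun B _ =>
      abs_sub_le_of_nonneg_of_le measureReal_nonneg measureReal_le_one
        measureReal_nonneg measureReal_le_one) hf hosc
  | succ t ih =>
    have hbind (ρ : Measure S) [IsProbabilityMeasure ρ] :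
        ∫ x, f x ∂(ρ.bind κ) = ∫ s, ∫ x, f x ∂(κ s) ∂ρ := by
      have : IsProbabilityMeasure (ρ.bind κ) :=
        isProbabilityMeasure_bind hκm.aemeasurable (.of_forall hκp)
      obtain ⟨x₀⟩ := nonempty_of_isProbabilityMeasure ρ
      refine ProbabilityTheory.Kernel.integral_comp (a := ())
        (η := (⟨κ, hκm⟩ : ProbabilityTheory.Kernel S S))
        (κ := ProbabilityTheory.Kernel.const Unit ρ) (f := f) ?_
      change Integrable f (ρ.bind κ)
      refine Integrable.of_bound hf.aestronglyMeasurable (|f x₀| + c) (.of_forall fun x => ?_)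
      rw [Real.norm_eq_abs, abs_le]
      constructor <;> linarith [hosc x x₀, hosc x₀ x, neg_abs_le (f x₀), le_abs_self (f x₀)]
    have hmeas : Measurable fun s => ∫ x, f x ∂(κ s) :=
      (hf.stronglyMeasurable.integral_kernel
        (κ := (⟨κ, hκm⟩ : ProbabilityTheory.Kernel S S))).measurable
    have hstep : ∀ s s', (∫ x, f x ∂(κ s)) - ∫ x, f x ∂(κ s') ≤ α * c := fun s s' =>
      (le_abs_self _).trans <| abs_integral_sub_integral_le_of_oscillation (κ s) (κ s')
        (fun B hB => by
          linarith [two_mul_abs_measureReal_sub_le_tvDist (κ s) (κ s') hB, hDoeblin s s'])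
        hf hosc
    have := isProbabilityMeasure_stepIter hκm hκp μ t
    calc |(∫ x, f x ∂π) - ∫ x, f x ∂(stepIter κ (t + 1) μ)|
        = |(∫ s, ∫ x, f x ∂(κ s) ∂π) - ∫ s, ∫ x, f x ∂(κ s) ∂(stepIter κ t μ)| := by
          rw [stepIter_succ, hbind, ← hbind π, hinv]
      _ ≤ α ^ t * (α * c) := ih hmeas hstep
      _ = α ^ (t + 1) * c := by ring

/-- For a Doeblin kernel `κ` with invariant probability measure `μ∞`
and a `[0,1]`-valued measurable reward `r̄`, setting `J = ∫ r̄ dμ∞`, for every initial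
state `s` and horizon `H`:
`|H·J − Σ_{h=0}^{H−1} ∫ r̄ dμ_h^s| ≤ 2/(1−α)`. -/
theorem transient_reward_bound {S : Type*} [MeasurableSpace S]
    (κ : S → Measure S) (hκm : Measurable κ)
    (hκp : ∀ s, IsProbabilityMeasure (κ s))
    (α : ℝ) (hα : α ∈ Set.Ioo (0 : ℝ) 1)
    (hDoeblin : ∀ s s' : S, tvDist (κ s) (κ s') ≤ 2 * α)
    (μinf : Measure S) [IsProbabilityMeasure μinf] (hinv : μinf.bind κ = μinf)
    (rbar : S → ℝ) (hrm : Measurable rbar) (hrb : ∀ s, rbar s ∈ Set.Icc (0 : ℝ) 1)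
    (s : S) (H : ℕ) :
    |(H : ℝ) * (∫ x, rbar x ∂μinf) -
        ∑ h ∈ Finset.range H, ∫ x, rbar x ∂(stepIter κ h (Measure.dirac s))| ≤
      2 / (1 - α) := by
  obtain ⟨hα0, hα1⟩ := hα
  have hterm (h : ℕ) :
      |(∫ x, rbar x ∂μinf) - ∫ x, rbar x ∂(stepIter κ h (Measure.dirac s))| ≤ α ^ h := by
    simpa using abs_integral_sub_integral_stepIter_le hκm hκp hDoeblin μinf hinv
      (Measure.dirac s) h hrm (c := 1) fun x y => by linarith [(hrb x).2, (hrb y).1]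
  calc |(H : ℝ) * (∫ x, rbar x ∂μinf) -
          ∑ h ∈ Finset.range H, ∫ x, rbar x ∂(stepIter κ h (Measure.dirac s))|
      = |∑ h ∈ Finset.range H,
          ((∫ x, rbar x ∂μinf) - ∫ x, rbar x ∂(stepIter κ h (Measure.dirac s)))| := by
        simp [Finset.sum_sub_distrib]
    _ ≤ ∑ h ∈ Finset.range H, α ^ h :=
        (Finset.abs_sum_le_sum_abs _ _).trans (Finset.sum_le_sum fun h _ => hterm h)
    _ ≤ ∑' h, α ^ h := (summable_geometric_of_lt_one hα0.le hα1).sum_le_tsum _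
        fun h _ => pow_nonneg hα0.le h
    _ = 1 / (1 - α) := by rw [tsum_geometric_of_lt_one hα0.le hα1, one_div]
    _ ≤ 2 / (1 - α) := by
        have : 0 < 1 - α := sub_pos.2 hα1
        gcongr
        norm_num
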